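/- Let k be an algebraically closed field of characteristic zero and A a finite-dimensional k-algebra. Choose a complete set of primitive orthogonal idempotents and representatives e_i ∈ A such that P_i = Ae_i are representatives of the isomorphism classes of indecomposable projective left A-modules, with simple tops S_i = Ae_i/J(A)e_i; let T_j = e_jA/e_jJ(A) be the simple top of the indecomposable projective right module e_jA, and let c_{ij} = dim_k Hom_A(P_i, P_j). Then for all a, b ∈ A, the trace of the k-linear map A → A, x ↦ a x b, equals Σ_{i,j} c_{ij} · χ^A_{S_i}(a) · tr_{T_j}(b), where tr_{T_j}(b) denotes the trace of the k-linear map t ↦ t·b on the right module T_j. -/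

import Mathlib

/-- The character of a finite-dimensional module `M` over a finite-dimensional `k`-algebra `A`:
it sends `a : A` to the trace of the `k`-linear map `m ↦ a • m` on `M`. -/
noncomputable def moduleChar (k : Type*) [Field k] {A : Type*} [Ring A] [Algebra k A]
    (M : Type*) [AddCommGroup M] [Module k M] [Module A M] [IsScalarTower k A M]
    (a : A) : k :=
  LinearMap.trace k M (DistribMulAction.toLinearMap k M a)

universe u v

/-- The indecomposable projective left `A`-module `Ae` generated by an idempotent `e`. -/
def leftIdemSubmodule (A : Type v) [Ring A] (e : A) : Submodule A A :=
  Submodule.span A ({e} : Set A)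

/-- The left submodule `J(A)e` of `A`, where `J(A)` is the Jacobson radical. -/
def leftRadSubmodule (A : Type v) [Ring A] (e : A) : Submodule A A :=
  Submodule.span A ((fun x => x * e) '' ((⊥ : Ideal A).jacobson : Set A))

/-- The simple top `Ae / J(A)e` of the indecomposable projective left module `Ae`. -/
abbrev leftIdemTop (A : Type v) [Ring A] (e : A) :=
  ↥(leftIdemSubmodule A e) ⧸
    Submodule.comap (leftIdemSubmodule A e).subtype (leftRadSubmodule A e)

/-- The indecomposable projective right `A`-module `eA` (a left `Aᵐᵒᵖ`-module). -/
def rightIdemSubmodule (A : Type v) [Ring A] (e : A) : Submodule Aᵐᵒᵖ A :=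
  Submodule.span Aᵐᵒᵖ ({e} : Set A)

/-- The right submodule `eJ(A)` of `A`, where `J(A)` is the Jacobson radical. -/
def rightRadSubmodule (A : Type v) [Ring A] (e : A) : Submodule Aᵐᵒᵖ A :=
  Submodule.span Aᵐᵒᵖ ((fun x => e * x) '' ((⊥ : Ideal A).jacobson : Set A))

/-- The simple top `eA / eJ(A)` of the indecomposable projective right module `eA`. -/
abbrev rightIdemTop (A : Type v) [Ring A] (e : A) :=
  ↥(rightIdemSubmodule A e) ⧸
    Submodule.comap (rightIdemSubmodule A e).subtype (rightRadSubmodule A e)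


section Helpers

variable {A : Type v} [Ring A]

/-- Indecomposability in the submodule form used by the statement. -/
def IndecMod (A : Type v) [Ring A] (U : Type v) [AddCommGroup U] [Module A U] : Prop :=
  ∀ V W : Submodule A U, IsCompl V W → V = ⊥ ∨ W = ⊥

lemma mem_leftIdem {f : A} (hf : IsIdempotentElem f) {x : A} :
    x ∈ leftIdemSubmodule A f ↔ x * f = x := by
  unfold leftIdemSubmodule
  rw [Submodule.mem_span_singleton]
  constructor
  · rintro ⟨a, rfl⟩
    rw [smul_eq_mul, mul_assoc, hf.eq]
  · intro h
    exact ⟨x, h⟩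

lemma mem_rightIdem {f : A} (hf : IsIdempotentElem f) {x : A} :
    x ∈ rightIdemSubmodule A f ↔ f * x = x := by
  unfold rightIdemSubmodule
  rw [Submodule.mem_span_singleton]
  constructor
  · rintro ⟨a, rfl⟩
    rw [MulOpposite.smul_eq_mul_unop, ← mul_assoc, hf.eq]
  · intro h
    exact ⟨MulOpposite.op x, by simpa [MulOpposite.smul_eq_mul_unop] using h⟩

lemma mem_leftRad {f x : A} (hx : x * f = x) :
    x ∈ leftRadSubmodule A f ↔ x ∈ (⊥ : Ideal A).jacobson := by
  unfold leftRadSubmodule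
  constructor
  · intro h
    have : Submodule.span A ((fun x => x * f) '' ((⊥ : Ideal A).jacobson : Set A))
        ≤ (⊥ : Ideal A).jacobson := by
      rw [Submodule.span_le]
      rintro _ ⟨y, hy, rfl⟩
      exact Ideal.mul_mem_right f _ hy
    exact this h
  · intro h
    exact Submodule.subset_span ⟨x, h, hx⟩

lemma mem_rightRad {f x : A} (hx : f * x = x) :
    x ∈ rightRadSubmodule A f ↔ x ∈ (⊥ : Ideal A).jacobson := by
  unfold rightRadSubmodule
  constructor
  · intro h
    clear hx
    induction h using Submodule.span_induction with
    | mem y hy =>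
      obtain ⟨y, hy, rfl⟩ := hy
      exact Ideal.mul_mem_left _ f hy
    | zero => exact Ideal.zero_mem _
    | add x y _ _ h1 h2 => exact Ideal.add_mem _ h1 h2
    | smul a x _ h1 =>
      rw [MulOpposite.smul_eq_mul_unop]
      exact Ideal.mul_mem_right _ _ h1
  · intro h
    exact Submodule.subset_span ⟨x, h, hx⟩

/-- Right multiplication by `z` as a map `Ae → Af`. -/
def rmulMap {e f z : A} (hf : IsIdempotentElem f) (hz : z * f = z) :
    leftIdemSubmodule A e →ₗ[A] leftIdemSubmodule A f where
  toFun x := ⟨x.1 * z, (mem_leftIdem hf).2 (by rw [mul_assoc, hz])⟩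
  map_add' x y := by ext; simp [add_mul]
  map_smul' a x := by ext; simp [mul_assoc]

@[simp] lemma rmulMap_coe {e f z : A} (hf : IsIdempotentElem f) (hz : z * f = z)
    (x : leftIdemSubmodule A e) : ((rmulMap hf hz x : leftIdemSubmodule A f) : A) = x.1 * z := rfl

lemma rmulMap_pow_coe {f z : A} (hf : IsIdempotentElem f) (hz : z * f = z) (n : ℕ)
    (x : leftIdemSubmodule A f) :
    ((((rmulMap hf hz : Module.End A (leftIdemSubmodule A f)) ^ n) x :
      leftIdemSubmodule A f) : A) = x.1 * z ^ n := by
  induction n generalizing x with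
  | zero => simp
  | succ n ih =>
    rw [pow_succ, Module.End.mul_apply, ih, rmulMap_coe, mul_assoc, pow_succ']

lemma projective_leftIdem {f : A} (hf : IsIdempotentElem f) :
    Module.Projective A (leftIdemSubmodule A f) := by
  refine Module.Projective.of_split (M := A) (leftIdemSubmodule A f).subtype
    { toFun := fun x => ⟨x * f, (mem_leftIdem hf).2 (by rw [mul_assoc, hf.eq])⟩
      map_add' := fun x y => by ext; simp [add_mul]
      map_smul' := fun a x => by ext; simp [mul_assoc] } ?_
  ext x
  exact (mem_leftIdem hf).1 x.2

lemma decomp_of_isCompl {f : A} (hf : IsIdempotentElem f)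
    {V W : Submodule A (leftIdemSubmodule A f)} (h : IsCompl V W) :
    ∃ g h : A, IsIdempotentElem g ∧ IsIdempotentElem h ∧ g * h = 0 ∧ h * g = 0 ∧ f = g + h ∧
      (g = 0 → V = ⊥) ∧ (h = 0 → W = ⊥) := by
  have hfm : f ∈ leftIdemSubmodule A f := (mem_leftIdem hf).2 hf
  have htop : (⟨f, hfm⟩ : leftIdemSubmodule A f) ∈ V ⊔ W := by
    rw [h.sup_eq_top]; trivial
  obtain ⟨⟨g, hg⟩, hgV, ⟨rr, hh⟩, hhW, hsum⟩ := Submodule.mem_sup.1 htop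
  have hs : g + rr = f := congrArg Subtype.val hsum
  have hgf : g * f = g := (mem_leftIdem hf).1 hg
  have hhf : rr * f = rr := (mem_leftIdem hf).1 hh
  have key : ∀ x : leftIdemSubmodule A f, x ∈ V → x ∈ W → x = 0 := fun x h1 h2 =>
    Submodule.disjoint_def.1 h.disjoint x h1 h2
  have hgh : g * rr = 0 := by
    have h1 : g • (⟨rr, hh⟩ : leftIdemSubmodule A f) = ⟨g, hg⟩ - g • ⟨g, hg⟩ := by
      ext
      simp only [Submodule.coe_smul, smul_eq_mul, Submodule.coe_sub]
      rw [eq_sub_iff_add_eq, ← mul_add, add_comm, hs, hgf]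
    have := key (g • ⟨rr, hh⟩) (by
      rw [h1]; exact V.sub_mem hgV (V.smul_mem _ hgV)) (W.smul_mem _ hhW)
    exact congrArg Subtype.val this
  have hhg : rr * g = 0 := by
    have h1 : rr • (⟨g, hg⟩ : leftIdemSubmodule A f) = ⟨rr, hh⟩ - rr • ⟨rr, hh⟩ := by
      ext
      simp only [Submodule.coe_smul, smul_eq_mul, Submodule.coe_sub]
      rw [eq_sub_iff_add_eq, ← mul_add, hs, hhf]
    have := key (rr • ⟨g, hg⟩) (V.smul_mem _ hgV) (by
      rw [h1]; exact W.sub_mem hhW (W.smul_mem _ hhW))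
    exact congrArg Subtype.val this
  have htopOf : ∀ X : Submodule A (leftIdemSubmodule A f),
      (⟨f, hfm⟩ : leftIdemSubmodule A f) ∈ X → X = ⊤ := by
    intro X hX
    rw [eq_top_iff]
    intro x _
    have : x = x.1 • (⟨f, hfm⟩ : leftIdemSubmodule A f) := by
      ext
      exact ((mem_leftIdem hf).1 x.2).symm
    rw [this]
    exact X.smul_mem _ hX
  refine ⟨g, rr, ?_, ?_, hgh, hhg, hs.symm, ?_, ?_⟩
  · have := hgf
    rw [← hs, mul_add, hgh, add_zero] at this
    exact this
  · have := hhf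
    rw [← hs, mul_add, hhg, zero_add] at this
    exact this
  · rintro rfl
    rw [zero_add] at hs
    subst hs
    have := htopOf W hhW
    subst this
    simpa using h.disjoint
  · rintro rfl
    rw [add_zero] at hs
    subst hs
    have := htopOf V hgV
    subst this
    simpa using h.disjoint

lemma exists_of_equiv {f e : A} (hf : IsIdempotentElem f) (he : IsIdempotentElem e)
    (φ : leftIdemSubmodule A f ≃ₗ[A] leftIdemSubmodule A e) :
    ∃ x y : A, x * y = f ∧ y * x = e := by
  have hfm : f ∈ leftIdemSubmodule A f := (mem_leftIdem hf).2 hf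
  have hem : e ∈ leftIdemSubmodule A e := (mem_leftIdem he).2 he
  have h1 : ∀ x : leftIdemSubmodule A f, (φ x : A) = x.1 * (φ ⟨f, hfm⟩ : A) := by
    intro x
    have : x = x.1 • (⟨f, hfm⟩ : leftIdemSubmodule A f) := by
      ext
      exact ((mem_leftIdem hf).1 x.2).symm
    conv_lhs => rw [this, map_smul]
    rfl
  have h2 : ∀ x : leftIdemSubmodule A e, (φ.symm x : A) = x.1 * (φ.symm ⟨e, hem⟩ : A) := by
    intro x
    have : x = x.1 • (⟨e, hem⟩ : leftIdemSubmodule A e) := by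
      ext
      exact ((mem_leftIdem he).1 x.2).symm
    conv_lhs => rw [this, map_smul]
    rfl
  refine ⟨(φ ⟨f, hfm⟩ : A), (φ.symm ⟨e, hem⟩ : A), ?_, ?_⟩
  · rw [← h2]; simp
  · rw [← h1]; simp

lemma equiv_of_exists {f e x y : A} (hf : IsIdempotentElem f) (he : IsIdempotentElem e)
    (hx : x * e = x) (hy : y * f = y) (hxy : x * y = f) (hyx : y * x = e) :
    Nonempty (leftIdemSubmodule A f ≃ₗ[A] leftIdemSubmodule A e) := by
  refine ⟨LinearEquiv.ofLinearMap (rmulMap he hx) (rmulMap hf hy) ?_ ?_⟩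
  · ext z
    simp [mul_assoc, hyx, (mem_leftIdem he).1 z.2]
  · ext z
    simp [mul_assoc, hxy, (mem_leftIdem hf).1 z.2]

variable (k : Type u) [Field k] [Algebra k A]

instance finite_leftIdem [FiniteDimensional k A] (f : A) :
    FiniteDimensional k (leftIdemSubmodule A f) :=
  inferInstanceAs (FiniteDimensional k ((leftIdemSubmodule A f).restrictScalars k))

instance finite_rightIdem [FiniteDimensional k A] (f : A) :
    FiniteDimensional k (rightIdemSubmodule A f) :=
  inferInstanceAs (FiniteDimensional k ((rightIdemSubmodule A f).restrictScalars k))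

lemma local_lemma [IsAlgClosed k] [FiniteDimensional k A] {f : A} (hf : IsIdempotentElem f)
    (hf0 : f ≠ 0) (hind : IndecMod A (leftIdemSubmodule A f)) {y : A} (hyf : y * f = y)
    (hfy : f * y = y) : ∃ c : k, IsNilpotent (y - c • f) := by
  have hfm : f ∈ leftIdemSubmodule A f := (mem_leftIdem hf).2 hf
  have : Nontrivial (leftIdemSubmodule A f) :=
    ⟨⟨⟨f, hfm⟩, 0, fun h => hf0 (congrArg Subtype.val h)⟩⟩
  have : IsArtinianRing A := IsArtinianRing.of_finite k A
  have : IsNoetherianRing A := IsNoetherianRing.of_finite k A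
  obtain ⟨c, hc⟩ := Module.End.exists_eigenvalue
    ((rmulMap hf hyf : leftIdemSubmodule A f →ₗ[A] leftIdemSubmodule A f).restrictScalars k)
  obtain ⟨v, hv⟩ := hc.exists_hasEigenvector
  have hv1 : v.1 * y = c • v.1 := congrArg Subtype.val hv.apply_eq_smul
  have hv0 : v ≠ 0 := hv.2
  refine ⟨c, ?_⟩
  set z := y - c • f with hz
  have hzf : z * f = z := by simp [hz, sub_mul, hyf, hf.eq]
  have hfz : f * z = z := by simp [hz, mul_sub, hfy, hf.eq]
  have hvz : v.1 * z = 0 := by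
    rw [hz, mul_sub, hv1, mul_smul_comm, (mem_leftIdem hf).1 v.2, sub_self]
  obtain ⟨n, hn⟩ := Filter.eventually_atTop.1 (LinearMap.eventually_isCompl_ker_pow_range_pow
    (rmulMap hf hzf : Module.End A (leftIdemSubmodule A f)))
  have hn1 := hn (n+1) (Nat.le_succ n)
  rcases hind _ _ hn1 with h | h
  · exfalso
    apply hv0
    have : v ∈ LinearMap.ker ((rmulMap hf hzf : Module.End A (leftIdemSubmodule A f)) ^ (n+1)) := by
      rw [LinearMap.mem_ker]
      ext
      rw [rmulMap_pow_coe, pow_succ', ← mul_assoc, hvz]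
      simp
    rw [h] at this
    simpa using this
  · rw [LinearMap.range_eq_bot] at h
    refine ⟨n+1, ?_⟩
    have := congrArg Subtype.val (LinearMap.congr_fun h ⟨f, hfm⟩)
    rw [rmulMap_pow_coe, pow_succ', ← mul_assoc, hfz] at this
    rw [pow_succ']
    simpa using this

/-- Trace-like functionals. -/
structure TraceLike (τ : A →ₗ[k] k) : Prop where
  comm : ∀ x y, τ (x * y) = τ (y * x)
  nil : ∀ x, IsNilpotent x → τ x = 0

variable {k}

lemma TraceLike.eq_zero [IsAlgClosed k] [FiniteDimensional k A] {τ : A →ₗ[k] k}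
    (hτ : TraceLike k τ) {I : Type v} {e : I → A} (hidem : ∀ i, IsIdempotentElem (e i))
    (hcomplete : ∀ (U : Type v) [AddCommGroup U] [Module A U], Module.Projective A U →
      Nontrivial U → (∀ V W : Submodule A U, IsCompl V W → V = ⊥ ∨ W = ⊥) →
      ∃ i, Nonempty (U ≃ₗ[A] ↥(leftIdemSubmodule A (e i))))
    (he : ∀ i, τ (e i) = 0) (x : A) : τ x = 0 := by
  have : IsArtinianRing A := IsArtinianRing.of_finite k A
  suffices H : ∀ (P : Submodule A A) (f : A), IsIdempotentElem f → leftIdemSubmodule A f = P →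
      τ (f * x * f) = 0 by
    simpa using H _ 1 IsIdempotentElem.one rfl
  intro P
  induction P using WellFoundedLT.induction with
  | ind P ih =>
  intro f hf hP
  by_cases hf0 : f = 0
  · simp [hf0]
  have hfm : f ∈ leftIdemSubmodule A f := (mem_leftIdem hf).2 hf
  by_cases hind : IndecMod A (leftIdemSubmodule A f)
  · have : Nontrivial (leftIdemSubmodule A f) :=
      ⟨⟨⟨f, hfm⟩, 0, fun h => hf0 (congrArg Subtype.val h)⟩⟩
    obtain ⟨i, ⟨φ⟩⟩ := hcomplete _ (projective_leftIdem hf) inferInstance hind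
    obtain ⟨p, q, h1, h2⟩ := exists_of_equiv hf (hidem i) φ
    have hτf : τ f = 0 := by rw [← h1, hτ.comm, h2, he]
    obtain ⟨c, hc⟩ := local_lemma k hf hf0 hind (y := f * x * f) (by rw [mul_assoc, hf.eq])
      (by rw [← mul_assoc, ← mul_assoc, hf.eq])
    have := hτ.nil _ hc
    simpa [hτf] using this
  · unfold IndecMod at hind
    push Not at hind
    obtain ⟨V, W, hVW, hV, hW⟩ := hind
    obtain ⟨g, h, hg, hh, hgh, hhg, hs, hgV, hhW⟩ := decomp_of_isCompl hf hVW
    have hg0 : g ≠ 0 := fun h => hV (hgV h)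
    have hh0 : h ≠ 0 := fun h => hW (hhW h)
    have hlt : ∀ g h : A, IsIdempotentElem g → IsIdempotentElem h → h * g = 0 → g * h = 0 →
        f = g + h → h ≠ 0 → leftIdemSubmodule A g < P := by
      intro g h hg hh hhg hgh hs hh0
      rw [← hP]
      refine lt_of_le_of_ne ?_ ?_
      · intro z hz
        rw [mem_leftIdem hg] at hz
        rw [mem_leftIdem hf, hs, mul_add, hz, ← hz, mul_assoc, hgh]
        simp
      · intro heq
        rw [← heq, mem_leftIdem hg, hs, add_mul, hg.eq, hhg] at hfm
        apply hh0
        simpa using hfm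
    have e1 := ih _ (hlt g h hg hh hhg hgh hs hh0) g hg rfl
    have e2 := ih _ (hlt h g hh hg hgh hhg (by rw [hs, add_comm]) hg0) h hh rfl
    have e3 : τ (g * x * h) = 0 := by rw [hτ.comm, ← mul_assoc, hhg]; simp
    have e4 : τ (h * x * g) = 0 := by rw [hτ.comm, ← mul_assoc, hgh]; simp
    have : f * x * f = g * x * g + g * x * h + h * x * g + h * x * h := by
      rw [hs]; noncomm_ring
    rw [this]
    simp [e1, e2, e3, e4]


variable (k)

lemma dichotomy [IsAlgClosed k] [FiniteDimensional k A] {e f x : A} (he : IsIdempotentElem e)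
    (he0 : e ≠ 0) (hind : IndecMod A (leftIdemSubmodule A e)) (hf : IsIdempotentElem f)
    (hxe : x * e = x) (hfx : f * x = x) :
    (∃ w, e * w = w ∧ w * f = w ∧ w * x = e) ∨ x ∈ (⊥ : Ideal A).jacobson := by
  by_cases hw : ∃ w, e * w = w ∧ w * f = w ∧ w * x = e
  · exact Or.inl hw
  right
  rw [Ideal.mem_jacobson_iff]
  intro y
  obtain ⟨c, hc⟩ := local_lemma k he he0 hind (y := e * y * x) (by rw [mul_assoc, hxe])
      (by rw [← mul_assoc, ← mul_assoc, he.eq])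
  by_cases hc0 : c = 0
  · subst hc0
    rw [zero_smul, sub_zero] at hc
    have key : ∀ n, x * (e * y * x) ^ n = x * (y * x) ^ n := by
      intro n
      induction n with
      | zero => simp
      | succ n ih =>
        rw [pow_succ, ← mul_assoc, ih, pow_succ (y * x), ← mul_assoc x]
        cases n with
        | zero => simp only [pow_zero, mul_one, ← mul_assoc, hxe]
        | succ m =>
          rw [pow_succ]
          have : x * e = x := hxe
          simp only [mul_assoc]
          rw [← mul_assoc x e, hxe]
    have hnil : IsNilpotent (y * x) := by
      obtain ⟨n, hn⟩ := hc
      refine ⟨n + 1, ?_⟩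
      rw [pow_succ', mul_assoc, ← key, hn]
      simp
    obtain ⟨u, hu⟩ := hnil.isUnit_one_add
    refine ⟨(u⁻¹ : Aˣ), ?_⟩
    have : ((u⁻¹ : Aˣ) : A) * (1 + y * x) = 1 := by rw [← hu]; simp
    rw [mul_add, mul_one, ← mul_assoc] at this
    rw [add_comm, this]
    simp
  · exfalso
    apply hw
    set n := e * y * x - c • e with hn
    have hne : n * e = n := by
      rw [hn, sub_mul, mul_assoc _ x e, hxe, smul_mul_assoc, he.eq]
    obtain ⟨u, hu⟩ := (hc.smul c⁻¹).isUnit_one_add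
    have h1 : (u : A) * e = c⁻¹ • (e * y * x) := by
      rw [hu, add_mul, one_mul, smul_mul_assoc, hne, hn, smul_sub, smul_smul,
        inv_mul_cancel₀ hc0, one_smul]
      abel
    have h2 : ((u⁻¹ : Aˣ) : A) * (c⁻¹ • (e * y * x)) = e := by
      rw [← h1, ← mul_assoc]; simp
    refine ⟨c⁻¹ • (e * (u⁻¹ : Aˣ) * (e * y * f)), ?_, ?_, ?_⟩
    · rw [mul_smul_comm, ← mul_assoc e, ← mul_assoc e, he.eq]
    · rw [smul_mul_assoc]
      simp only [mul_assoc, hf.eq]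
    · rw [smul_mul_assoc]
      simp only [mul_assoc, hfx]
      rw [mul_smul_comm] at h2
      rw [← mul_smul_comm]
      simp only [mul_assoc] at h2
      rw [h2, he.eq]

lemma mem_jac_of_not_equiv [IsAlgClosed k] [FiniteDimensional k A] {e f x : A}
    (he : IsIdempotentElem e)
    (he0 : e ≠ 0) (hind : IndecMod A (leftIdemSubmodule A e)) (hf : IsIdempotentElem f)
    (hprim : ∀ p q : A, IsIdempotentElem p → IsIdempotentElem q →
      p * q = 0 → q * p = 0 → f = p + q → p = 0 ∨ q = 0)
    (hne : ¬ Nonempty (leftIdemSubmodule A f ≃ₗ[A] leftIdemSubmodule A e))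
    (hxe : x * e = x) (hfx : f * x = x) : x ∈ (⊥ : Ideal A).jacobson := by
  rcases dichotomy k he he0 hind hf hxe hfx with ⟨w, h1, h2, h3⟩ | h
  · exfalso
    have hp : IsIdempotentElem (x * w) := by
      change x * w * (x * w) = x * w
      rw [mul_assoc, ← mul_assoc w, h3, h1]
    have hfp : f * (x * w) = x * w := by rw [← mul_assoc, hfx]
    have hpf : (x * w) * f = x * w := by rw [mul_assoc, h2]
    have hpp : x * w * (x * w) = x * w := hp
    have hff : f * f = f := hf
    rcases hprim (x * w) (f - x * w) hp
      (by change (f - x * w) * (f - x * w) = f - x * w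
          rw [sub_mul, mul_sub, mul_sub, hff, hfp, hpf, hpp]; abel)
      (by rw [mul_sub, hpf, hpp, sub_self]) (by rw [sub_mul, hfp, hpp, sub_self])
      (by abel) with h | h
    · apply he0
      rw [← he.eq, ← h3, mul_assoc, ← mul_assoc x, h]
      simp
    · exact hne (equiv_of_exists hf he hxe h2 (sub_eq_zero.1 h).symm h3)
  · exact h

lemma mem_jac_of_nil [IsAlgClosed k] [FiniteDimensional k A] {e x : A}
    (he : IsIdempotentElem e)
    (he0 : e ≠ 0) (hind : IndecMod A (leftIdemSubmodule A e))
    (hxe : x * e = x) (hex : e * x = x) (hnil : IsNilpotent x) :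
    x ∈ (⊥ : Ideal A).jacobson := by
  rcases dichotomy k he he0 hind he hxe hex with ⟨w, h1, h2, h3⟩ | h
  · exfalso
    obtain ⟨n, hn⟩ := hnil
    have : ∀ n, x ^ (n + 1) = 0 → False := by
      intro n
      induction n with
      | zero =>
        intro h
        rw [zero_add, pow_one] at h
        rw [h, mul_zero] at h3
        exact he0 h3.symm
      | succ n ih =>
        intro h
        apply ih
        have h4 : x ^ (n + 1) = e * x ^ (n + 1) := by rw [pow_succ', ← mul_assoc, hex]
        rw [h4, ← h3, mul_assoc, ← pow_succ', h, mul_zero]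
    exact this n (by rw [pow_succ, hn, zero_mul])
  · exact h

lemma not_mem_jac {e : A} (he : IsIdempotentElem e) (he0 : e ≠ 0) :
    e ∉ (⊥ : Ideal A).jacobson := by
  intro h
  rw [Ideal.mem_jacobson_iff] at h
  obtain ⟨z, hz⟩ := h (-1)
  rw [Ideal.mem_bot] at hz
  apply he0
  have h2 : (z * (-1) * e + z - 1) * e = 0 := by rw [hz, zero_mul]
  rw [sub_mul, add_mul, mul_assoc _ e e, he.eq] at h2
  simpa using h2

lemma trace_eq_one {M : Type*} [AddCommGroup M] [Module k M] [FiniteDimensional k M]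
    (T : M →ₗ[k] M) (v : M) (hv : v ≠ 0) (hT : T v = v) (h : ∀ m, ∃ c : k, T m = c • v) :
    LinearMap.trace k M T = 1 := by
  have hp : LinearMap.IsProj (k ∙ v) T := by
    constructor
    · intro m
      obtain ⟨c, hc⟩ := h m
      rw [hc]
      exact Submodule.smul_mem _ _ (Submodule.mem_span_singleton_self v)
    · intro m hm
      obtain ⟨c, rfl⟩ := Submodule.mem_span_singleton.1 hm
      rw [map_smul, hT]
  rw [hp.trace, finrank_span_singleton hv]
  simp

lemma trace_eq_zero {M : Type*} [AddCommGroup M] [Module k M]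
    (T : M →ₗ[k] M) (h : ∀ m, T m = 0) : LinearMap.trace k M T = 0 := by
  have : T = 0 := LinearMap.ext h
  rw [this, map_zero]

/-- Corner elements of a primitive idempotent are scalar modulo the radical. -/
lemma corner_scalar [IsAlgClosed k] [FiniteDimensional k A] {e x : A}
    (he : IsIdempotentElem e)
    (he0 : e ≠ 0) (hind : IndecMod A (leftIdemSubmodule A e))
    (hxe : x * e = x) (hex : e * x = x) :
    ∃ c : k, x - c • e ∈ (⊥ : Ideal A).jacobson := by
  obtain ⟨c, hc⟩ := local_lemma k he he0 hind hxe hex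
  refine ⟨c, mem_jac_of_nil k he he0 hind ?_ ?_ hc⟩
  · rw [sub_mul, hxe, smul_mul_assoc, he.eq]
  · rw [mul_sub, hex, mul_smul_comm, he.eq]

lemma char_left_self [IsAlgClosed k] [FiniteDimensional k A] {e : A}
    (he : IsIdempotentElem e)
    (he0 : e ≠ 0) (hind : IndecMod A (leftIdemSubmodule A e)) :
    moduleChar k (leftIdemTop A e) e = 1 := by
  have hem : e ∈ leftIdemSubmodule A e := (mem_leftIdem he).2 he
  refine trace_eq_one k _ (Submodule.Quotient.mk ⟨e, hem⟩) ?_ ?_ ?_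
  · intro h
    rw [Submodule.Quotient.mk_eq_zero] at h
    exact not_mem_jac he he0 ((mem_leftRad he).1 h)
  · change Submodule.Quotient.mk (e • (⟨e, hem⟩ : leftIdemSubmodule A e)) = _
    congr 1
    ext
    exact he
  · intro m
    obtain ⟨x, rfl⟩ := Submodule.Quotient.mk_surjective _ m
    have hx : x.1 * e = x.1 := (mem_leftIdem he).1 x.2
    obtain ⟨c, hc⟩ := corner_scalar k he he0 hind (x := e * x.1)
      (by rw [mul_assoc, hx]) (by rw [← mul_assoc, he.eq])
    refine ⟨c, ?_⟩
    change Submodule.Quotient.mk (e • x) =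
      Submodule.Quotient.mk (c • (⟨e, hem⟩ : leftIdemSubmodule A e))
    rw [Submodule.Quotient.eq]
    refine (mem_leftRad ?_).2 hc
    change (e * x.1 - c • e) * e = e * x.1 - c • e
    rw [sub_mul, mul_assoc, hx, smul_mul_assoc, he.eq]

lemma char_right_self [IsAlgClosed k] [FiniteDimensional k A] {e : A}
    (he : IsIdempotentElem e)
    (he0 : e ≠ 0) (hind : IndecMod A (leftIdemSubmodule A e)) :
    moduleChar k (rightIdemTop A e) (MulOpposite.op e) = 1 := by
  have hem : e ∈ rightIdemSubmodule A e := (mem_rightIdem he).2 he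
  refine trace_eq_one k _ (Submodule.Quotient.mk ⟨e, hem⟩) ?_ ?_ ?_
  · intro h
    rw [Submodule.Quotient.mk_eq_zero] at h
    exact not_mem_jac he he0 ((mem_rightRad he).1 h)
  · change Submodule.Quotient.mk (MulOpposite.op e • (⟨e, hem⟩ : rightIdemSubmodule A e)) = _
    congr 1
    ext
    exact he
  · intro m
    obtain ⟨x, rfl⟩ := Submodule.Quotient.mk_surjective _ m
    have hx : e * x.1 = x.1 := (mem_rightIdem he).1 x.2
    obtain ⟨c, hc⟩ := corner_scalar k he he0 hind (x := x.1 * e)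
      (by rw [mul_assoc, he.eq]) (by rw [← mul_assoc, hx])
    refine ⟨c, ?_⟩
    change Submodule.Quotient.mk (MulOpposite.op e • x) =
      Submodule.Quotient.mk (c • (⟨e, hem⟩ : rightIdemSubmodule A e))
    rw [Submodule.Quotient.eq]
    refine (mem_rightRad ?_).2 hc
    change e * (x.1 * e - c • e) = x.1 * e - c • e
    rw [mul_sub, ← mul_assoc, hx, mul_smul_comm, he.eq]

lemma char_left_ne {e f : A} (he : IsIdempotentElem e)
    (h : ∀ x, x * e = x → f * x = x → x ∈ (⊥ : Ideal A).jacobson) (hf : IsIdempotentElem f) :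
    moduleChar k (leftIdemTop A e) f = 0 := by
  refine trace_eq_zero k _ ?_
  intro m
  obtain ⟨x, rfl⟩ := Submodule.Quotient.mk_surjective _ m
  have hx : x.1 * e = x.1 := (mem_leftIdem he).1 x.2
  change Submodule.Quotient.mk (f • x) = 0
  rw [Submodule.Quotient.mk_eq_zero]
  have h1 : f * x.1 * e = f * x.1 := by rw [mul_assoc, hx]
  exact (mem_leftRad h1).2 (h _ h1 (by rw [← mul_assoc, hf.eq]))

lemma char_right_ne {e f : A} (he : IsIdempotentElem e)
    (h : ∀ x, x * f = x → e * x = x → x ∈ (⊥ : Ideal A).jacobson) (hf : IsIdempotentElem f) :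
    moduleChar k (rightIdemTop A e) (MulOpposite.op f) = 0 := by
  refine trace_eq_zero k _ ?_
  intro m
  obtain ⟨x, rfl⟩ := Submodule.Quotient.mk_surjective _ m
  have hx : e * x.1 = x.1 := (mem_rightIdem he).1 x.2
  change Submodule.Quotient.mk (MulOpposite.op f • x) = 0
  rw [Submodule.Quotient.mk_eq_zero]
  have h1 : e * (x.1 * f) = x.1 * f := by rw [← mul_assoc, hx]
  exact (mem_rightRad h1).2 (h _ (by rw [mul_assoc, hf.eq]) h1)

lemma trace_corner [FiniteDimensional k A] {e f : A} (he : IsIdempotentElem e)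
    (hf : IsIdempotentElem f) :
    LinearMap.trace k A ((LinearMap.mulLeft k e).comp (LinearMap.mulRight k f)) =
      (Module.finrank k (leftIdemSubmodule A e →ₗ[A] leftIdemSubmodule A f) : k) := by
  have hem : e ∈ leftIdemSubmodule A e := (mem_leftIdem he).2 he
  have hev : ∀ (φ : leftIdemSubmodule A e →ₗ[A] leftIdemSubmodule A f)
      (x : leftIdemSubmodule A e), (φ x : A) = x.1 * (φ ⟨e, hem⟩ : A) := by
    intro φ x
    have : x = x.1 • (⟨e, hem⟩ : leftIdemSubmodule A e) := by
      ext
      exact ((mem_leftIdem he).1 x.2).symm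
    conv_lhs => rw [this, map_smul]
    rfl
  let Ev : (leftIdemSubmodule A e →ₗ[A] leftIdemSubmodule A f) →ₗ[k] A :=
    { toFun := fun φ => (φ ⟨e, hem⟩ : A)
      map_add' := fun _ _ => rfl
      map_smul' := fun _ _ => rfl }
  have hinj : Function.Injective Ev := by
    intro φ ψ h
    ext x
    rw [hev φ, hev ψ]
    exact congrArg (x.1 * ·) h
  have hp : LinearMap.IsProj (LinearMap.range Ev)
      ((LinearMap.mulLeft k e).comp (LinearMap.mulRight k f)) := by
    constructor
    · intro x
      have hz : e * (x * f) * f = e * (x * f) := by simp only [mul_assoc, hf.eq]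
      refine ⟨rmulMap hf hz, ?_⟩
      change e * (e * (x * f)) = e * (x * f)
      rw [← mul_assoc, he.eq]
    · rintro _ ⟨φ, rfl⟩
      change e * ((φ ⟨e, hem⟩ : A) * f) = (φ ⟨e, hem⟩ : A)
      rw [(mem_leftIdem hf).1 (φ ⟨e, hem⟩).2]
      exact (hev φ ⟨e, hem⟩).symm
  rw [hp.trace, LinearMap.finrank_range_of_inj hinj]

/-- The character as a linear functional. -/
noncomputable def charLin {B : Type*} [Ring B] [Algebra k B]
    (M : Type*) [AddCommGroup M] [Module k M] [Module B M] [IsScalarTower k B M] : B →ₗ[k] k :=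
  (LinearMap.trace k M).comp (Algebra.lsmul k k M).toLinearMap

lemma charLin_apply {B : Type*} [Ring B] [Algebra k B]
    (M : Type*) [AddCommGroup M] [Module k M] [Module B M] [IsScalarTower k B M] (x : B) :
    charLin k M x = moduleChar k M x := rfl

lemma charLin_traceLike {B : Type v} [Ring B] [Algebra k B]
    (M : Type*) [AddCommGroup M] [Module k M] [Module B M] [IsScalarTower k B M] :
    TraceLike k (charLin k M : B →ₗ[k] k) where
  comm x y := by
    change LinearMap.trace k M (Algebra.lsmul k k M (x * y)) =
      LinearMap.trace k M (Algebra.lsmul k k M (y * x))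
    rw [map_mul (Algebra.lsmul k k M), map_mul (Algebra.lsmul k k M), LinearMap.trace_mul_comm]
  nil x hx := (LinearMap.isNilpotent_trace_of_isNilpotent
    (hx.map (Algebra.lsmul k k M : B →ₐ[k] _))).eq_zero

/-- The right character as a linear functional. -/
noncomputable def charLinOp
    (M : Type*) [AddCommGroup M] [Module k M] [Module Aᵐᵒᵖ M] [IsScalarTower k Aᵐᵒᵖ M] :
    A →ₗ[k] k :=
  (charLin k M).comp (MulOpposite.opLinearEquiv k : A ≃ₗ[k] Aᵐᵒᵖ).toLinearMap

lemma charLinOp_apply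
    (M : Type*) [AddCommGroup M] [Module k M] [Module Aᵐᵒᵖ M] [IsScalarTower k Aᵐᵒᵖ M] (x : A) :
    charLinOp k M x = moduleChar k M (MulOpposite.op x) := rfl

lemma charLinOp_traceLike
    (M : Type*) [AddCommGroup M] [Module k M] [Module Aᵐᵒᵖ M] [IsScalarTower k Aᵐᵒᵖ M] :
    TraceLike k (charLinOp k M : A →ₗ[k] k) where
  comm x y := (charLin_traceLike k M).comm (MulOpposite.op y) (MulOpposite.op x)
  nil x hx := (charLin_traceLike k M).nil (MulOpposite.op x) (by
    obtain ⟨n, hn⟩ := hx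
    exact ⟨n, by rw [← MulOpposite.op_pow, hn, MulOpposite.op_zero]⟩)

variable {k}

lemma TraceLike.sub {σ τ : A →ₗ[k] k} (hσ : TraceLike k σ) (hτ : TraceLike k τ) :
    TraceLike k (σ - τ) where
  comm x y := by simp [hσ.comm x y, hτ.comm x y]
  nil x hx := by simp [hσ.nil x hx, hτ.nil x hx]

lemma TraceLike.sum_smul {I : Type*} [Fintype I] {τ : I → A →ₗ[k] k} (c : I → k)
    (hτ : ∀ i, TraceLike k (τ i)) : TraceLike k (∑ i, c i • τ i) where
  comm x y := by simp [fun i => (hτ i).comm x y]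
  nil x hx := by simp [fun i => (hτ i).nil x hx]

variable (k)

/-- `a ↦ tr (x ↦ a x b)`. -/
noncomputable def bimodL (b : A) : A →ₗ[k] k where
  toFun a := LinearMap.trace k A ((LinearMap.mulLeft k a).comp (LinearMap.mulRight k b))
  map_add' x y := by
    rw [← map_add]; congr 1; ext z; simp [add_mul]
  map_smul' c x := by
    rw [← map_smul]; congr 1; ext z; simp

/-- `b ↦ tr (x ↦ a x b)`. -/
noncomputable def bimodR (a : A) : A →ₗ[k] k where
  toFun b := LinearMap.trace k A ((LinearMap.mulLeft k a).comp (LinearMap.mulRight k b))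
  map_add' x y := by
    rw [← map_add]; congr 1; ext z; simp [mul_add]
  map_smul' c x := by
    rw [← map_smul]; congr 1; ext z; simp

lemma commute_lr (a b : A) : Commute (LinearMap.mulLeft k a : Module.End k A)
    (LinearMap.mulRight k b : Module.End k A) := by
  change (LinearMap.mulLeft k a : Module.End k A) * LinearMap.mulRight k b =
    LinearMap.mulRight k b * LinearMap.mulLeft k a
  ext z
  simp [mul_assoc]

lemma bimodL_traceLike (b : A) : TraceLike k (bimodL k b) where
  comm x y := by
    change LinearMap.trace k A (LinearMap.mulLeft k (x * y) * LinearMap.mulRight k b) =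
      LinearMap.trace k A (LinearMap.mulLeft k (y * x) * LinearMap.mulRight k b)
    have h1 : (LinearMap.mulLeft k (x * y) * LinearMap.mulRight k b : Module.End k A) =
      LinearMap.mulLeft k x * (LinearMap.mulLeft k y * LinearMap.mulRight k b) := by
      ext z; simp [mul_assoc]
    have h2 : (LinearMap.mulLeft k (y * x) * LinearMap.mulRight k b : Module.End k A) =
      (LinearMap.mulLeft k y * LinearMap.mulRight k b) * LinearMap.mulLeft k x := by
      ext z; simp [mul_assoc]
    rw [h1, h2, LinearMap.trace_mul_comm]
  nil x hx := by
    refine (LinearMap.isNilpotent_trace_of_isNilpotent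
      ((commute_lr k x b).isNilpotent_mul_right ?_)).eq_zero
    exact hx.map (Algebra.lmul k A)

lemma bimodR_traceLike (a : A) : TraceLike k (bimodR k a) where
  comm x y := by
    change LinearMap.trace k A (LinearMap.mulLeft k a * LinearMap.mulRight k (x * y)) =
      LinearMap.trace k A (LinearMap.mulLeft k a * LinearMap.mulRight k (y * x))
    have h1 : (LinearMap.mulLeft k a * LinearMap.mulRight k (x * y) : Module.End k A) =
      LinearMap.mulRight k y * (LinearMap.mulLeft k a * LinearMap.mulRight k x) := by
      ext z; simp [mul_assoc]
    have h2 : (LinearMap.mulLeft k a * LinearMap.mulRight k (y * x) : Module.End k A) =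
      (LinearMap.mulLeft k a * LinearMap.mulRight k x) * LinearMap.mulRight k y := by
      ext z; simp [mul_assoc]
    rw [h1, h2, LinearMap.trace_mul_comm]
  nil x hx := by
    refine (LinearMap.isNilpotent_trace_of_isNilpotent
      ((commute_lr k a x).isNilpotent_mul_left ?_)).eq_zero
    obtain ⟨n, hn⟩ := hx
    exact ⟨n, by rw [LinearMap.pow_mulRight, hn, LinearMap.mulRight_zero_eq_zero]⟩

end Helpers

/-- Let `k` be an algebraically closed field of characteristic zero and `A`
a finite-dimensional `k`-algebra.  Choose primitive orthogonal idempotents `e i ∈ A` such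
that the `P i = A (e i)` are representatives of the isomorphism classes of indecomposable
projective left `A`-modules, with simple tops `S i = A(e i)/J(A)(e i)`; let
`T j = (e j)A/(e j)J(A)` be the simple top of the indecomposable projective right module
`(e j)A`, and let `c i j = dim_k Hom_A(P i, P j)`.  Then for all `a, b ∈ A`, the trace of
the `k`-linear map `A → A, x ↦ a x b` equals
`∑_{i,j} c i j ⬝ χ^A_{S i}(a) ⬝ tr_{T j}(b)`, where `tr_{T j}(b)` is the trace of the
`k`-linear map `t ↦ t · b` on the right module `T j`. -/
theorem trace_bimodule_eq_cartan_left_right_characters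
    (k : Type u) [Field k] [IsAlgClosed k] [CharZero k]
    (A : Type v) [Ring A] [Algebra k A] [FiniteDimensional k A]
    (I : Type v) [Fintype I] (e : I → A)
    (hidem : ∀ i, IsIdempotentElem (e i)) (hne : ∀ i, e i ≠ 0)
    (hprim : ∀ i, ∀ f g : A, IsIdempotentElem f → IsIdempotentElem g →
      f * g = 0 → g * f = 0 → e i = f + g → f = 0 ∨ g = 0)
    (horth : ∀ i j, i ≠ j → e i * e j = 0)
    (hdistinct : ∀ i j,
      Nonempty (↥(leftIdemSubmodule A (e i)) ≃ₗ[A] ↥(leftIdemSubmodule A (e j))) → i = j)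
    (hcomplete : ∀ (U : Type v) [AddCommGroup U] [Module A U], Module.Projective A U →
      Nontrivial U → (∀ V W : Submodule A U, IsCompl V W → V = ⊥ ∨ W = ⊥) →
      ∃ i, Nonempty (U ≃ₗ[A] ↥(leftIdemSubmodule A (e i))))
    (a b : A) :
    LinearMap.trace k A ((LinearMap.mulLeft k a).comp (LinearMap.mulRight k b))
      = ∑ i, ∑ j,
          (Module.finrank k
              (↥(leftIdemSubmodule A (e i)) →ₗ[A] ↥(leftIdemSubmodule A (e j))) : k)
            * moduleChar k (leftIdemTop A (e i)) a
            * moduleChar k (rightIdemTop A (e j)) (MulOpposite.op b) := by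
  classical
  have hind : ∀ i, IndecMod A (leftIdemSubmodule A (e i)) := by
    intro i V W hVW
    obtain ⟨g, h, hg, hh, hgh, hhg, hs, hgV, hhW⟩ := decomp_of_isCompl (hidem i) hVW
    rcases hprim i g h hg hh hgh hhg hs with h0 | h0
    · exact Or.inl (hgV h0)
    · exact Or.inr (hhW h0)
  have hjac : ∀ i j, i ≠ j → ∀ x, x * e j = x → e i * x = x → x ∈ (⊥ : Ideal A).jacobson := by
    intro i j hij x h1 h2
    exact mem_jac_of_not_equiv k (hidem j) (hne j) (hind j) (hidem i) (hprim i)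
      (fun h => hij (hdistinct i j h)) h1 h2
  have hL : ∀ i l, moduleChar k (leftIdemTop A (e l)) (e i) = if l = i then 1 else 0 := by
    intro i l
    split_ifs with h
    · subst h
      exact char_left_self k (hidem _) (hne _) (hind _)
    · exact char_left_ne k (hidem l) (hjac i l (Ne.symm h)) (hidem i)
  have hR : ∀ j m, moduleChar k (rightIdemTop A (e m)) (MulOpposite.op (e j)) =
      if m = j then 1 else 0 := by
    intro j m
    split_ifs with h
    · subst h
      exact char_right_self k (hidem _) (hne _) (hind _)
    · exact char_right_ne k (hidem m) (hjac m j h) (hidem j)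
  let c : I → I → k := fun i j => (Module.finrank k
    (↥(leftIdemSubmodule A (e i)) →ₗ[A] ↥(leftIdemSubmodule A (e j))) : k)
  -- right variable, left variable an idempotent
  have step1 : ∀ i b, LinearMap.trace k A
      ((LinearMap.mulLeft k (e i)).comp (LinearMap.mulRight k b)) =
      ∑ j, c i j * moduleChar k (rightIdemTop A (e j)) (MulOpposite.op b) := by
    intro i b
    have h := ((bimodR_traceLike k (e i)).sub (TraceLike.sum_smul (fun j => c i j)
      (fun j => charLinOp_traceLike k (rightIdemTop A (e j))))).eq_zero hidem hcomplete ?_ b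
    · rw [LinearMap.sub_apply, sub_eq_zero, LinearMap.sum_apply] at h
      exact h
    · intro j
      rw [LinearMap.sub_apply, sub_eq_zero, LinearMap.sum_apply]
      simp only [LinearMap.smul_apply, charLinOp_apply, hR, smul_eq_mul]
      refine (trace_corner k (hidem i) (hidem j)).trans ?_
      simp [c]
  have h := ((bimodL_traceLike k b).sub (TraceLike.sum_smul
      (fun i => ∑ j, c i j * moduleChar k (rightIdemTop A (e j)) (MulOpposite.op b))
      (fun i => charLin_traceLike k (leftIdemTop A (e i))))).eq_zero hidem hcomplete ?_ a
  · rw [LinearMap.sub_apply, sub_eq_zero, LinearMap.sum_apply] at h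
    refine h.trans ?_
    refine Finset.sum_congr rfl fun i _ => ?_
    rw [LinearMap.smul_apply, charLin_apply, smul_eq_mul, Finset.sum_mul]
    refine Finset.sum_congr rfl fun j _ => ?_
    simp only [c]
    ring
  · intro i
    rw [LinearMap.sub_apply, sub_eq_zero, LinearMap.sum_apply]
    simp only [LinearMap.smul_apply, charLin_apply, hL, smul_eq_mul]
    refine (step1 i b).trans ?_
    simp
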